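/- Let ε ∈ (0, 1/4) and let m > 1 be a constant such that 1 − 1/m ≤ ((e−1)/(2√π · e)) √ε. Let F ∈ Lip_loc(ℝ) satisfy F(p) = p^m/m for p ∈ [0,1] and F(p) ≤ p for p ∈ [−1,0], and let g(x) = max{1 − |x|, 0} for x ∈ ℝ. Let u^ε be a bounded uniformly continuous viscosity solution of u_t + F(u_x) = ε u_xx in ℝ×(0,∞) with u^ε(·,0) = g, and let u be a bounded uniformly continuous viscosity solution of u_t + F(u_x) = 0 in ℝ×(0,∞) with u(·,0) = g. Then |u^ε(0,1) − u(0,1)| ≥ ((e−1)/(2√π · e)) √ε. -/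

import Mathlib

noncomputable section

/-- `w` is a viscosity subsolution of `w_t + F(w_x) = ε w_xx` in `ℝ × (0,∞)`:
for every `C²` test function `φ` and every point `(x₀,t₀)` with `t₀ > 0` at which
`w - φ` attains a local maximum, `∂_t φ + F(∂_x φ) ≤ ε ∂²_{xx} φ` at `(x₀,t₀)`. -/
def IsViscositySubsolution (F : ℝ → ℝ) (ε : ℝ) (w : ℝ × ℝ → ℝ) : Prop :=
  ∀ φ : ℝ × ℝ → ℝ, ContDiff ℝ 2 φ →
    ∀ x₀ t₀ : ℝ, 0 < t₀ →
      IsLocalMax (fun p => w p - φ p) (x₀, t₀) →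
      deriv (fun τ => φ (x₀, τ)) t₀ + F (deriv (fun ξ => φ (ξ, t₀)) x₀)
        ≤ ε * deriv (deriv (fun ξ => φ (ξ, t₀))) x₀

/-- `w` is a viscosity supersolution of `w_t + F(w_x) = ε w_xx` in `ℝ × (0,∞)`. -/
def IsViscositySupersolution (F : ℝ → ℝ) (ε : ℝ) (w : ℝ × ℝ → ℝ) : Prop :=
  ∀ φ : ℝ × ℝ → ℝ, ContDiff ℝ 2 φ →
    ∀ x₀ t₀ : ℝ, 0 < t₀ →
      IsLocalMin (fun p => w p - φ p) (x₀, t₀) →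
      ε * deriv (deriv (fun ξ => φ (ξ, t₀))) x₀
        ≤ deriv (fun τ => φ (x₀, τ)) t₀ + F (deriv (fun ξ => φ (ξ, t₀)) x₀)

/-- `w` is a bounded uniformly continuous viscosity solution of the Cauchy problem
`w_t + F(w_x) = ε w_xx` in `ℝ × (0,∞)`, `w(·,0) = g`. -/
def IsViscositySolutionCauchy (F : ℝ → ℝ) (ε : ℝ) (g : ℝ → ℝ) (w : ℝ × ℝ → ℝ) : Prop :=
  (∃ M : ℝ, ∀ p : ℝ × ℝ, |w p| ≤ M) ∧
  UniformContinuousOn w {p : ℝ × ℝ | 0 ≤ p.2} ∧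
  IsViscositySubsolution F ε w ∧
  IsViscositySupersolution F ε w ∧
  (∀ x : ℝ, w (x, 0) = g x)

section
open Filter Topology Real

lemma sub_local {F : ℝ → ℝ} {ε : ℝ} {w : ℝ × ℝ → ℝ} (h : IsViscositySubsolution F ε w)
    {φ : ℝ × ℝ → ℝ} {x₀ t₀ : ℝ} (ht : 0 < t₀) (hφ : ContDiffAt ℝ 2 φ (x₀, t₀))
    (hmax : IsLocalMax (fun p => w p - φ p) (x₀, t₀)) :
    deriv (fun τ => φ (x₀, τ)) t₀ + F (deriv (fun ξ => φ (ξ, t₀)) x₀)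
        ≤ ε * deriv (deriv (fun ξ => φ (ξ, t₀))) x₀ := by
  obtain ⟨r, hr, hball⟩ := Metric.eventually_nhds_iff_ball.1 (hφ.eventually (by simp))
  let χ : ContDiffBump ((x₀, t₀) : ℝ × ℝ) := ⟨r / 4, r / 2, by positivity, by linarith⟩
  have hχ : ContDiff ℝ 2 (fun p => χ p * φ p) := by
    rw [contDiff_iff_contDiffAt]
    intro p
    by_cases hp : p ∈ tsupport χ
    · rw [χ.tsupport_eq] at hp
      have : p ∈ Metric.ball (x₀, t₀) r :=
        Metric.closedBall_subset_ball (by change r / 2 < r; linarith) hp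
      exact χ.contDiff.contDiffAt.mul (hball p this)
    · have h0 : (fun p => χ p * φ p) =ᶠ[𝓝 p] fun _ => (0:ℝ) := by
        have := notMem_tsupport_iff_eventuallyEq.1 hp
        filter_upwards [this] with q hq
        simp [hq]
      exact contDiffAt_const.congr_of_eventuallyEq h0
  have heq : (fun p => χ p * φ p) =ᶠ[𝓝 (x₀, t₀)] φ := by
    filter_upwards [χ.eventuallyEq_one] with q hq
    simp [hq]
  have hmax' : IsLocalMax (fun p => w p - χ p * φ p) (x₀, t₀) := by
    refine hmax.congr ?_
    filter_upwards [heq] with q hq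
    simp_all
  have key := h _ hχ x₀ t₀ ht hmax'
  have c1 : Tendsto (fun τ : ℝ => (x₀, τ)) (𝓝 t₀) (𝓝 (x₀, t₀)) :=
    (Continuous.prodMk continuous_const continuous_id).tendsto t₀
  have c2 : Tendsto (fun ξ : ℝ => (ξ, t₀)) (𝓝 x₀) (𝓝 (x₀, t₀)) :=
    (Continuous.prodMk continuous_id continuous_const).tendsto x₀
  have e1 : (fun τ => χ (x₀, τ) * φ (x₀, τ)) =ᶠ[𝓝 t₀] fun τ => φ (x₀, τ) := c1.eventually heq
  have e2 : (fun ξ => χ (ξ, t₀) * φ (ξ, t₀)) =ᶠ[𝓝 x₀] fun ξ => φ (ξ, t₀) := c2.eventually heq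
  rw [e1.deriv_eq, e2.deriv_eq, e2.deriv.deriv_eq] at key
  exact key

lemma sq_deriv (x : ℝ) : HasDerivAt (fun ξ : ℝ => √(1 + ξ ^ 2)) (x / √(1 + x ^ 2)) x := by
  have h : HasDerivAt (fun ξ : ℝ => 1 + ξ ^ 2) (2 * x) x := by
    simpa using (hasDerivAt_pow 2 x).const_add 1
  convert h.sqrt (by positivity) using 1
  field_simp

lemma sq_deriv2 (x : ℝ) : HasDerivAt (fun ξ : ℝ => ξ / √(1 + ξ ^ 2))
    (1 / (√(1 + x ^ 2) * (1 + x ^ 2))) x := by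
  have hp : 0 < √(1 + x ^ 2) := by positivity
  have hs : √(1 + x ^ 2) ^ 2 = 1 + x ^ 2 := Real.sq_sqrt (by positivity)
  refine HasDerivAt.congr_deriv ((hasDerivAt_id x).div (sq_deriv x) hp.ne') ?_
  simp only [id]
  field_simp
  rw [hs]; ring

lemma abs_div_sq_le (x : ℝ) : |x / √(1 + x ^ 2)| ≤ 1 := by
  have hp : 0 < √(1 + x ^ 2) := by positivity
  rw [abs_div, abs_of_pos hp, div_le_one hp]
  exact Real.abs_le_sqrt (by linarith)

lemma compare {F : ℝ → ℝ} {ε : ℝ} (hε : 0 ≤ ε) (hF : Continuous F) {u : ℝ × ℝ → ℝ}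
    (hb : ∃ M : ℝ, ∀ p : ℝ × ℝ, |u p| ≤ M) (hc : ContinuousOn u {p : ℝ × ℝ | 0 ≤ p.2})
    (hu : IsViscositySubsolution F ε u)
    (w : ℝ × ℝ → ℝ) (wt wx wxx : ℝ → ℝ → ℝ)
    (hwc : ContinuousOn w {p : ℝ × ℝ | 0 ≤ p.2})
    (hwb : ∃ B : ℝ, ∀ p : ℝ × ℝ, 0 ≤ p.2 → B ≤ w p)
    (hw2 : ∀ x t, 0 < t → ContDiffAt ℝ 2 w (x, t))
    (hwt : ∀ x t, 0 < t → HasDerivAt (fun τ => w (x, τ)) (wt x t) t)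
    (hwx : ∀ x t, 0 < t → HasDerivAt (fun ξ => w (ξ, t)) (wx x t) x)
    (hwxx : ∀ x t, 0 < t → HasDerivAt (fun ξ => wx ξ t) (wxx x t) x)
    (hslope : ∀ x t, 0 < t → |wx x t| ≤ 1)
    (heq : ∀ x t, 0 < t → ε * wxx x t ≤ wt x t + F (wx x t))
    (h0 : ∀ x, u (x, 0) ≤ w (x, 0)) (x₁ t₁ : ℝ) (ht₁ : 0 ≤ t₁) :
    u (x₁, t₁) ≤ w (x₁, t₁) := by
  obtain ⟨M, hM⟩ := hb
  obtain ⟨B, hB⟩ := hwb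
  have main : ∀ η : ℝ, 0 < η → u (x₁, t₁) ≤ w (x₁, t₁) + η * (t₁ + √(1 + x₁ ^ 2)) := by
    intro η hη
    have huc : UniformContinuousOn F (Set.Icc (-2) 2) :=
      isCompact_Icc.uniformContinuousOn_of_continuous hF.continuousOn
    obtain ⟨δ, hδ, hδF⟩ := Metric.uniformContinuousOn_iff.1 huc (η / 2) (by positivity)
    obtain ⟨γ, hγ, hγη, hγδ, hγ1, hγε⟩ :
        ∃ γ : ℝ, 0 < γ ∧ γ ≤ η ∧ γ < δ ∧ γ ≤ 1 ∧ ε * γ ≤ η / 2 := by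
      refine ⟨min (min η (δ / 2)) (min 1 (η / 2 / (ε + 1))), by positivity, ?_, ?_, ?_, ?_⟩
      · exact (min_le_left _ _).trans (min_le_left _ _)
      · exact lt_of_le_of_lt ((min_le_left _ _).trans (min_le_right _ _)) (by linarith)
      · exact (min_le_right _ _).trans (min_le_left _ _)
      · have h1 : min (min η (δ / 2)) (min 1 (η / 2 / (ε + 1))) ≤ η / 2 / (ε + 1) :=
          (min_le_right _ _).trans (min_le_right _ _)
        have h2 : 0 ≤ η / 2 / (ε + 1) := by positivity
        calc ε * _ ≤ ε * (η / 2 / (ε + 1)) := mul_le_mul_of_nonneg_left h1 hε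
          _ ≤ (ε + 1) * (η / 2 / (ε + 1)) := by nlinarith
          _ = η / 2 := by field_simp
    let φ : ℝ × ℝ → ℝ := fun p => w p + η * p.2 + γ * √(1 + p.1 ^ 2)
    have hle : u (x₁, t₁) ≤ φ (x₁, t₁) := by
      by_contra hcon
      push Not at hcon
      have hsm : Continuous fun p : ℝ × ℝ => η * p.2 + γ * √(1 + p.1 ^ 2) := by fun_prop
      have hψc : ContinuousOn (fun p => u p - φ p) {p : ℝ × ℝ | 0 ≤ p.2} := by
        refine hc.sub ?_
        have := hwc.add hsm.continuousOn
        refine this.congr fun p _ => ?_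
        simp only [φ, Pi.add_apply]; ring
      have hcl : IsClosed {p : ℝ × ℝ | 0 ≤ p.2} := isClosed_le continuous_const continuous_snd
      have hmem : (x₁, t₁) ∈ {p : ℝ × ℝ | 0 ≤ p.2} := ht₁
      obtain ⟨⟨x₀, t₀⟩, hp0, hmax⟩ := hψc.exists_isMaxOn' hcl hmem (by
        have hK : IsCompact (Set.Icc (-(|M - B| / γ)) (|M - B| / γ) ×ˢ
            Set.Icc (0:ℝ) (|M - B| / η)) := isCompact_Icc.prod isCompact_Icc
        rw [Filter.eventually_inf_principal]
        filter_upwards [hK.compl_mem_cocompact] with ⟨x, t⟩ hx ht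
        have ht : 0 ≤ t := ht
        refine le_trans ?_ (sub_nonneg.2 hcon.le)
        have a1 := (abs_le.1 (hM (x, t))).2
        have a2 := hB (x, t) ht
        have a3 : |x| ≤ √(1 + x ^ 2) := Real.abs_le_sqrt (by linarith)
        have a4 := le_abs_self (M - B)
        simp only [φ]
        by_cases hx1 : |x| ≤ |M - B| / γ
        · have : |M - B| / η < t := by
            by_contra hcc
            push Not at hcc
            exact hx ⟨abs_le.1 hx1, ht, hcc⟩
          rw [div_lt_iff₀ hη] at this
          have : 0 ≤ γ * √(1 + x ^ 2) := by positivity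
          nlinarith
        · push Not at hx1
          rw [div_lt_iff₀ hγ] at hx1
          have : γ * |x| ≤ γ * √(1 + x ^ 2) := mul_le_mul_of_nonneg_left a3 hγ.le
          have : 0 ≤ η * t := by positivity
          nlinarith)
      have hpos : 0 < u (x₀, t₀) - φ (x₀, t₀) :=
        lt_of_lt_of_le (sub_pos.2 hcon) (hmax hmem)
      have ht0 : 0 < t₀ := by
        rcases (show (0:ℝ) ≤ t₀ from hp0).lt_or_eq with h | h
        · exact h
        · exfalso
          subst h
          have := h0 x₀
          have h2 : 0 ≤ γ * √(1 + x₀ ^ 2) := by positivity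
          simp only [φ] at hpos
          linarith
      have hloc : IsLocalMax (fun p => u p - φ p) (x₀, t₀) := by
        refine hmax.isLocalMax ?_
        have : {p : ℝ × ℝ | 0 < p.2} ∈ 𝓝 (x₀, t₀) :=
          (isOpen_lt continuous_const continuous_snd).mem_nhds ht0
        filter_upwards [this] with q hq
        exact le_of_lt hq
      have hφ2 : ContDiffAt ℝ 2 φ (x₀, t₀) := by
        have hs : ContDiff ℝ 2 fun p : ℝ × ℝ => √(1 + p.1 ^ 2) :=
          ContDiff.sqrt (by fun_prop) (fun p => by positivity)
        have h3 : ContDiff ℝ 2 fun p : ℝ × ℝ => η * p.2 := by fun_prop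
        exact ((hw2 x₀ t₀ ht0).add h3.contDiffAt).add (contDiff_const.mul hs).contDiffAt
      have key := sub_local hu ht0 hφ2 hloc
      have d1 : deriv (fun τ => φ (x₀, τ)) t₀ = wt x₀ t₀ + η := by
        have := ((hwt x₀ t₀ ht0).add ((hasDerivAt_id t₀).const_mul η)).add_const
          (γ * √(1 + x₀ ^ 2))
        rw [mul_one] at this
        exact this.deriv
      have d2 : ∀ x, deriv (fun ξ => φ (ξ, t₀)) x = wx x t₀ + γ * (x / √(1 + x ^ 2)) := by
        intro x
        exact (((hwx x t₀ ht0).add_const (η * t₀)).add ((sq_deriv x).const_mul γ)).deriv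
      have d3 : deriv (deriv (fun ξ => φ (ξ, t₀))) x₀
          = wxx x₀ t₀ + γ * (1 / (√(1 + x₀ ^ 2) * (1 + x₀ ^ 2))) := by
        rw [show deriv (fun ξ => φ (ξ, t₀)) = fun x => wx x t₀ + γ * (x / √(1 + x ^ 2)) from
          funext d2]
        exact ((hwxx x₀ t₀ ht0).add ((sq_deriv2 x₀).const_mul γ)).deriv
      rw [d1, d2, d3] at key
      have hE := heq x₀ t₀ ht0
      have hS := abs_le.1 (hslope x₀ t₀ ht0)
      have hD : |γ * (x₀ / √(1 + x₀ ^ 2))| ≤ γ := by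
        rw [abs_mul, abs_of_pos hγ]
        exact mul_le_of_le_one_right hγ.le (abs_div_sq_le x₀)
      have hD' := abs_le.1 hD
      have hFF := hδF (wx x₀ t₀) ⟨by linarith, by linarith⟩
        (wx x₀ t₀ + γ * (x₀ / √(1 + x₀ ^ 2))) ⟨by linarith, by linarith⟩ (by
          rw [Real.dist_eq, abs_sub_comm]
          simpa using lt_of_le_of_lt hD hγδ)
      rw [Real.dist_eq] at hFF
      have hFF' := (abs_lt.1 hFF).2
      have hlast : ε * (γ * (1 / (√(1 + x₀ ^ 2) * (1 + x₀ ^ 2)))) ≤ η / 2 := by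
        refine le_trans (mul_le_mul_of_nonneg_left ?_ hε) hγε
        refine mul_le_of_le_one_right hγ.le ?_
        have h1 : 1 ≤ √(1 + x₀ ^ 2) := Real.one_le_sqrt.2 (by nlinarith [sq_nonneg x₀])
        rw [div_le_one (by positivity)]
        nlinarith [sq_nonneg x₀]
      rw [mul_add] at key
      linarith
    have h5 : 0 ≤ √(1 + x₁ ^ 2) := Real.sqrt_nonneg _
    simp only [φ] at hle
    nlinarith
  have hlim : Tendsto (fun η : ℝ => w (x₁, t₁) + η * (t₁ + √(1 + x₁ ^ 2))) (𝓝[>] 0)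
      (𝓝 (w (x₁, t₁) + 0 * (t₁ + √(1 + x₁ ^ 2)))) :=
    (Continuous.tendsto (by fun_prop) 0).mono_left nhdsWithin_le_nhds
  rw [zero_mul, add_zero] at hlim
  refine ge_of_tendsto hlim ?_
  filter_upwards [self_mem_nhdsWithin] with η hη
  exact main η hη

lemma neg_super {F : ℝ → ℝ} {ε : ℝ} {u : ℝ × ℝ → ℝ} (h : IsViscositySupersolution F ε u) :
    IsViscositySubsolution (fun p => -F (-p)) ε (fun p => -u p) := by
  intro φ hφ x₀ t₀ ht hmax
  have hmin : IsLocalMin (fun p => u p - (-φ p)) (x₀, t₀) := by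
    have := hmax.neg
    refine this.congr (Eventually.of_forall fun p => ?_)
    simp only; ring
  have key := h (fun p => -φ p) hφ.neg x₀ t₀ ht hmin
  have e : deriv (fun ξ => -φ (ξ, t₀)) = fun x => -deriv (fun ξ => φ (ξ, t₀)) x := by
    funext x; exact deriv.fun_neg
  rw [e] at key
  simp only [deriv.fun_neg] at key
  linarith

def Phi (y : ℝ) : ℝ := 1 / 2 + (1 / √π) * ∫ z in (0:ℝ)..y, Real.exp (-z ^ 2)

def GG (y : ℝ) : ℝ := y * Phi y + Real.exp (-y ^ 2) / (2 * √π)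

lemma Phi_deriv (y : ℝ) : HasDerivAt Phi (Real.exp (-y ^ 2) / √π) y := by
  have hc : Continuous fun z : ℝ => Real.exp (-z ^ 2) := by fun_prop
  have := ((hc.integral_hasStrictDerivAt 0 y).hasDerivAt.const_mul (1 / √π)).const_add (1 / 2)
  rw [one_div_mul_eq_div] at this
  exact this

lemma exp_deriv (y : ℝ) : HasDerivAt (fun z : ℝ => Real.exp (-z ^ 2))
    (-(2 * y) * Real.exp (-y ^ 2)) y := by
  have h : HasDerivAt (fun z : ℝ => -z ^ 2) (-(2 * y)) y := by
    simpa using (hasDerivAt_pow 2 y).fun_neg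
  convert h.exp using 1
  ring

lemma sqrtpi_pos : 0 < √π := Real.sqrt_pos.2 Real.pi_pos

lemma GG_deriv (y : ℝ) : HasDerivAt GG (Phi y) y := by
  have := ((hasDerivAt_id y).mul (Phi_deriv y)).add ((exp_deriv y).div_const (2 * √π))
  refine HasDerivAt.congr_deriv this ?_
  have := sqrtpi_pos
  simp only [id]
  field_simp
  ring

lemma Phi_contDiff : ContDiff ℝ 2 Phi := by
  have h1 : deriv Phi = fun y => Real.exp (-y ^ 2) / √π := funext fun y => (Phi_deriv y).deriv
  rw [show (2 : WithTop ℕ∞) = 1 + 1 by norm_num, contDiff_succ_iff_deriv]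
  refine ⟨fun y => (Phi_deriv y).differentiableAt, by simp, ?_⟩
  rw [h1]
  fun_prop

lemma GG_contDiff : ContDiff ℝ 2 GG := by
  unfold GG
  have := Phi_contDiff
  fun_prop

lemma Phi_neg (y : ℝ) : Phi (-y) = 1 - Phi y := by
  have : ∫ z in (0:ℝ)..(-y), Real.exp (-z ^ 2) = -∫ z in (0:ℝ)..y, Real.exp (-z ^ 2) := by
    have h := intervalIntegral.integral_comp_neg (a := 0) (b := y) (fun z => Real.exp (-z ^ 2))
    simp only [neg_sq, neg_zero] at h
    rw [h, intervalIntegral.integral_symm]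
  unfold Phi
  rw [this]; ring

lemma Phi_tendsto : Tendsto Phi atTop (𝓝 1) := by
  have hi : MeasureTheory.IntegrableOn (fun z : ℝ => Real.exp (-z ^ 2)) (Set.Ioi 0) := by
    have := (integrable_exp_neg_mul_sq (b := 1) one_pos).integrableOn (s := Set.Ioi 0)
    simpa using this
  have h := MeasureTheory.intervalIntegral_tendsto_integral_Ioi 0 hi tendsto_id
  have hv : ∫ z in Set.Ioi (0:ℝ), Real.exp (-z ^ 2) = √π / 2 := by
    simpa using integral_gaussian_Ioi 1
  rw [hv] at h
  have h2 := (h.const_mul (1 / √π)).const_add (1 / 2)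
  have := sqrtpi_pos
  rw [show (1 / 2 + 1 / √π * (√π / 2)) = 1 by field_simp; norm_num] at h2
  exact h2

lemma Phi_mono : Monotone Phi :=
  monotone_of_deriv_nonneg (fun y => (Phi_deriv y).differentiableAt)
    (fun y => by rw [(Phi_deriv y).deriv]; positivity)

lemma Phi_le_one (y : ℝ) : Phi y ≤ 1 := Phi_mono.ge_of_tendsto Phi_tendsto y

lemma Phi_nonneg (y : ℝ) : 0 ≤ Phi y := by
  have := Phi_le_one (-y)
  rw [Phi_neg] at this
  linarith

lemma GG_neg (y : ℝ) : GG (-y) = GG y - y := by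
  unfold GG
  rw [Phi_neg, neg_sq]; ring

/-- the function `exp(-y²)/(c√π y)` -/
lemma tail_deriv (c : ℝ) (y : ℝ) (hy : 0 < y) :
    HasDerivAt (fun z => c * (Real.exp (-z ^ 2) / z) - √π * (1 - Phi z))
      (Real.exp (-y ^ 2) * (1 - 2 * c - c / y ^ 2)) y := by
  have := (((exp_deriv y).div (hasDerivAt_id y) hy.ne').const_mul c).sub
    (((Phi_deriv y).const_sub 1).const_mul (√π))
  refine HasDerivAt.congr_deriv this ?_
  have := sqrtpi_pos
  simp only [id]
  field_simp
  ring

lemma tail_tendsto (c : ℝ) :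
    Tendsto (fun z => c * (Real.exp (-z ^ 2) / z) - √π * (1 - Phi z)) atTop (𝓝 0) := by
  have h1 : Tendsto (fun z : ℝ => Real.exp (-z ^ 2) / z) atTop (𝓝 0) := by
    refine squeeze_zero' (g := fun z : ℝ => z⁻¹) ?_ ?_ tendsto_inv_atTop_zero
    · filter_upwards [eventually_gt_atTop 0] with z hz
      positivity
    · filter_upwards [eventually_gt_atTop 0] with z hz
      rw [div_eq_mul_inv]
      refine mul_le_of_le_one_left (by positivity) (Real.exp_le_one_iff.2 ?_)
      nlinarith
  have := (h1.const_mul c).sub ((Phi_tendsto.const_sub 1).const_mul (√π))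
  simpa using this

lemma tail_upper (y : ℝ) (hy : 0 < y) : √π * (1 - Phi y) ≤ Real.exp (-y ^ 2) / (2 * y) := by
  have hanti : AntitoneOn (fun z => (1/2) * (Real.exp (-z ^ 2) / z) - √π * (1 - Phi z))
      (Set.Ici y) := by
    refine antitoneOn_of_deriv_nonpos (convex_Ici y) ?_ ?_ ?_
    · intro z hz
      exact (tail_deriv _ z (hy.trans_le hz)).continuousAt.continuousWithinAt
    · intro z hz
      rw [interior_Ici] at hz
      exact (tail_deriv _ z (hy.trans hz)).differentiableAt.differentiableWithinAt
    · intro z hz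
      rw [interior_Ici] at hz
      rw [(tail_deriv _ z (hy.trans hz)).deriv]
      have : 0 ≤ (1/2) / z ^ 2 := by positivity
      exact mul_nonpos_of_nonneg_of_nonpos (Real.exp_pos _).le (by linarith)
  have := le_of_tendsto (tail_tendsto (1/2)) (by
    filter_upwards [eventually_ge_atTop y] with z hz
    exact hanti (Set.mem_Ici.2 le_rfl) hz hz)
  have h2 : Real.exp (-y ^ 2) / (2 * y) = (1/2) * (Real.exp (-y ^ 2) / y) := by ring
  rw [h2]; linarith

lemma tail_lower : Real.exp (-1) / 4 ≤ √π * (1 - Phi 1) := by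
  have hmono : MonotoneOn (fun z => (1/4) * (Real.exp (-z ^ 2) / z) - √π * (1 - Phi z))
      (Set.Ici 1) := by
    refine monotoneOn_of_deriv_nonneg (convex_Ici 1) ?_ ?_ ?_
    · intro z hz
      exact (tail_deriv _ z (one_pos.trans_le hz)).continuousAt.continuousWithinAt
    · intro z hz
      rw [interior_Ici] at hz
      exact (tail_deriv _ z (one_pos.trans hz)).differentiableAt.differentiableWithinAt
    · intro z hz
      rw [interior_Ici] at hz
      rw [(tail_deriv _ z (one_pos.trans hz)).deriv]
      have hz' : (1:ℝ) < z := hz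
      have : (1/4) / z ^ 2 ≤ 1/4 := div_le_self (by norm_num) (by nlinarith)
      exact mul_nonneg (Real.exp_pos _).le (by linarith)
  have := ge_of_tendsto (tail_tendsto (1/4)) (by
    filter_upwards [eventually_ge_atTop 1] with z hz
    exact hmono (Set.mem_Ici.2 le_rfl) hz hz)
  norm_num at this
  linarith

lemma GG_mono : Monotone GG :=
  monotone_of_deriv_nonneg (fun y => (GG_deriv y).differentiableAt)
    (fun y => by rw [(GG_deriv y).deriv]; exact Phi_nonneg y)

lemma GG_nonneg (y : ℝ) : 0 ≤ GG y := by
  have hneg : ∀ y : ℝ, 0 < y → 0 ≤ GG (-y) := by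
    intro y hy
    have h := tail_upper y hy
    have hs := sqrtpi_pos
    unfold GG
    rw [Phi_neg, neg_sq]
    rw [le_div_iff₀ (by positivity)] at h
    have : y * (1 - Phi y) ≤ Real.exp (-y ^ 2) / (2 * √π) := by
      rw [le_div_iff₀ (by positivity)]; linarith
    linarith
  rcases lt_or_ge y 0 with h | h
  · simpa using hneg (-y) (by linarith)
  · exact (hneg 1 one_pos).trans (GG_mono (by linarith))

lemma GG_ge_self (y : ℝ) : y ≤ GG y := by
  have := GG_nonneg (-y)
  rw [GG_neg] at this
  linarith

lemma GG_zero : GG 0 = 1 / (2 * √π) := by simp [GG]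

lemma GG_le (y : ℝ) : GG y ≤ max y 0 + 1 / 2 := by
  have h1 : Real.exp (-y ^ 2) / (2 * √π) ≤ 1 / 2 := by
    have : 1 ≤ √π := Real.one_le_sqrt.2 (by linarith [Real.pi_gt_three])
    refine div_le_div₀ zero_le_one (Real.exp_le_one_iff.2 (by nlinarith)) (by norm_num) (by linarith)
  have h2 : y * Phi y ≤ max y 0 := by
    rcases le_total y 0 with h | h
    · exact (mul_nonpos_of_nonpos_of_nonneg h (Phi_nonneg y)).trans (le_max_right _ _)
    · exact (mul_le_of_le_one_right h (Phi_le_one y)).trans (le_max_left _ _)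
  unfold GG
  linarith

lemma GG_lip (a b : ℝ) (h : 0 ≤ b) : GG (a + b) ≤ GG a + b := by
  have : Antitone fun y => GG y - y :=
    antitone_of_deriv_nonpos (fun y => ((GG_deriv y).sub (hasDerivAt_id y)).differentiableAt)
      (fun y => by
        have := ((GG_deriv y).sub (hasDerivAt_id y)).deriv
        erw [this]
        linarith [Phi_le_one y])
  have := this (show a ≤ a + b by linarith)
  simp only at this
  linarith

lemma GG_neg_one : GG (-1) ≤ Real.exp (-1) / (4 * √π) := by
  have h := tail_lower
  have hs := sqrtpi_pos
  have h1 : Real.exp (-1) / (4 * √π) ≤ 1 - Phi 1 := by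
    rw [div_le_iff₀ (by positivity)]; linarith
  have h2 : Real.exp (-1) / (2 * √π) = 2 * (Real.exp (-1) / (4 * √π)) := by
    field_simp; norm_num
  unfold GG
  rw [Phi_neg, neg_sq, one_pow, h2]
  linarith

lemma K_dx (r c x : ℝ) (hr : 0 < r) :
    HasDerivAt (fun ξ => r * GG ((ξ + c) / r)) (Phi ((x + c) / r)) x := by
  have h1 : HasDerivAt (fun ξ : ℝ => (ξ + c) / r) (1 / r) x :=
    ((hasDerivAt_id x).add_const c).div_const r
  have h2 := ((GG_deriv ((x + c) / r)).comp x h1).const_mul r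
  refine HasDerivAt.congr_deriv h2 ?_
  field_simp

lemma K_dxx (r c x : ℝ) :
    HasDerivAt (fun ξ => Phi ((ξ + c) / r)) (Real.exp (-((x + c) / r) ^ 2) / √π * (1 / r)) x := by
  have h1 : HasDerivAt (fun ξ : ℝ => (ξ + c) / r) (1 / r) x :=
    ((hasDerivAt_id x).add_const c).div_const r
  have h2 := (Phi_deriv ((x + c) / r)).comp x h1
  exact h2

lemma K_dt (r : ℝ → ℝ) (r' a t : ℝ) (hr : 0 < r t) (hd : HasDerivAt r r' t) :
    HasDerivAt (fun τ => r τ * GG ((a - τ) / r τ))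
      (r' * (Real.exp (-((a - t) / r t) ^ 2) / (2 * √π)) - Phi ((a - t) / r t)) t := by
  have h1 := ((hasDerivAt_id t).const_sub a).div hd hr.ne'
  have h2 := hd.mul ((GG_deriv ((a - t) / r t)).comp t h1)
  refine HasDerivAt.congr_deriv h2 ?_
  have h3 : GG ((a - t) / r t) = (a - t) / r t * Phi ((a - t) / r t)
    + Real.exp (-((a - t) / r t) ^ 2) / (2 * √π) := rfl
  simp only [Function.comp_apply, id, Pi.div_apply]
  rw [h3]
  generalize Real.exp (-((a - t) / r t) ^ 2) / (2 * √π) = E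
  generalize Phi ((a - t) / r t) = P
  field_simp
  ring

lemma upper_bound {m : ℝ} (hm : 1 < m) {F : ℝ → ℝ} (hF : Continuous F)
    (hF1 : ∀ p ∈ Set.Icc (0:ℝ) 1, F p = p ^ m / m)
    {g : ℝ → ℝ} (hg : ∀ x : ℝ, g x = max (1 - |x|) 0) {u : ℝ × ℝ → ℝ}
    (hu : IsViscositySolutionCauchy F 0 g u) : u (0, 1) ≤ 1 - 1 / m := by
  obtain ⟨hb, huc, hsub, -, h0⟩ := hu
  have main : ∀ s : ℝ, 0 < s → u (0, 1) ≤ s * GG 0 + (1 - 1 / m) := by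
    intro s hs
    have ha : 0 ≤ 1 - 1 / m := by
      rw [sub_nonneg, div_le_one (by linarith)]; exact hm.le
    have hcd : ContDiff ℝ 2 fun p : ℝ × ℝ =>
        s * GG ((p.1 + (1 - p.2)) / s) + (1 - 1 / m) * p.2 := by
      have := GG_contDiff
      fun_prop
    have := compare le_rfl hF hb huc.continuousOn hsub
      (fun p => s * GG ((p.1 + (1 - p.2)) / s) + (1 - 1 / m) * p.2)
      (fun x t => -Phi ((x + (1 - t)) / s) + (1 - 1 / m))
      (fun x t => Phi ((x + (1 - t)) / s))
      (fun x t => Real.exp (-((x + (1 - t)) / s) ^ 2) / √π * (1 / s))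
      hcd.continuous.continuousOn
      ⟨0, fun p hp => by
        have := GG_nonneg ((p.1 + (1 - p.2)) / s)
        positivity⟩
      (fun x t _ => hcd.contDiffAt)
      (fun x t _ => by
        have h1 := K_dt (fun _ => s) 0 (x + 1) t hs (hasDerivAt_const t s)
        have h2 := h1.add ((hasDerivAt_id t).const_mul (1 - 1 / m))
        simp only [zero_mul, zero_sub, mul_one] at h2
        have e : ∀ τ : ℝ, x + 1 - τ = x + (1 - τ) := fun τ => by ring
        simp only [e] at h2
        exact h2)
      (fun x t _ => (K_dx s (1 - t) x hs).add_const ((1 - 1 / m) * t))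
      (fun x t _ => K_dxx s (1 - t) x)
      (fun x t _ => by
        rw [abs_of_nonneg (Phi_nonneg _)]; exact Phi_le_one _)
      (fun x t _ => by
        have p0 := Phi_nonneg ((x + (1 - t)) / s)
        have p1 := Phi_le_one ((x + (1 - t)) / s)
        rw [hF1 _ ⟨p0, p1⟩]
        generalize Phi ((x + (1 - t)) / s) = p at *
        have hB := one_add_mul_self_le_rpow_one_add (s := p - 1) (by linarith) hm.le
        rw [add_sub_cancel] at hB
        have : (1 + m * (p - 1)) / m ≤ p ^ m / m :=
          div_le_div_of_nonneg_right hB (by linarith)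
        have e : (1 + m * (p - 1)) / m = 1 / m + (p - 1) := by
          field_simp
        rw [zero_mul]
        linarith)
      (fun x => by
        rw [h0, hg]
        simp only [sub_zero, mul_zero, add_zero]
        have h1 : x + 1 ≤ s * GG ((x + 1) / s) := by
          have := mul_le_mul_of_nonneg_left (GG_ge_self ((x + 1) / s)) hs.le
          rwa [mul_div_cancel₀ _ hs.ne'] at this
        have h2 : 0 ≤ s * GG ((x + 1) / s) := mul_nonneg hs.le (GG_nonneg _)
        refine max_le ?_ h2
        linarith [neg_abs_le x])
      0 1 zero_le_one
    simpa using this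
  have hlim : Tendsto (fun s : ℝ => s * GG 0 + (1 - 1 / m)) (𝓝[>] 0)
      (𝓝 (0 * GG 0 + (1 - 1 / m))) :=
    (Continuous.tendsto (by fun_prop) 0).mono_left nhdsWithin_le_nhds
  rw [zero_mul, zero_add] at hlim
  refine ge_of_tendsto hlim ?_
  filter_upwards [self_mem_nhdsWithin] with s hs
  exact main s hs

lemma lower_bound {ε : ℝ} (hε : ε ∈ Set.Ioo (0:ℝ) (1/4)) {F : ℝ → ℝ} (hF : Continuous F)
    (hFle : ∀ p ∈ Set.Icc (-1:ℝ) 1, F p ≤ p)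
    {g : ℝ → ℝ} (hg : ∀ x : ℝ, g x = max (1 - |x|) 0) {u : ℝ × ℝ → ℝ}
    (hu : IsViscositySolutionCauchy F ε g u) :
    √ε / √π * (1 - Real.exp (-1)) ≤ u (0, 1) := by
  obtain ⟨⟨M, hM⟩, huc, -, hsup, h0⟩ := hu
  obtain ⟨hε0, hε1⟩ := hε
  have hpi := sqrtpi_pos
  have main : ∀ s : ℝ, 0 < s → s ^ 2 < 1 - 4 * ε →
      √ε / √π * (1 - Real.exp (-1)) ≤ u (0, 1) + s := by
    intro s hs hsε
    let r : ℝ → ℝ := fun t => √(4 * ε * t + s ^ 2)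
    have harg : ∀ t, 0 ≤ t → 0 < 4 * ε * t + s ^ 2 := fun t ht => by positivity
    have hr : ∀ t, 0 ≤ t → 0 < r t := fun t ht => Real.sqrt_pos.2 (harg t ht)
    have hrd : ∀ t, 0 ≤ t → HasDerivAt r (2 * ε / r t) t := by
      intro t ht
      have h1 : HasDerivAt (fun t : ℝ => 4 * ε * t + s ^ 2) (4 * ε * 1) t :=
        ((hasDerivAt_id t).const_mul (4 * ε)).add_const _
      refine (h1.sqrt (harg t ht).ne').congr_deriv ?_
      have := hr t ht
      simp only [r] at this ⊢
      field_simp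
      norm_num
    let w : ℝ × ℝ → ℝ := fun p => 2 * (r p.2 * GG ((p.1 + (0 - p.2)) / r p.2))
      - r p.2 * GG ((p.1 + (1 - p.2)) / r p.2) + s
    have hw2 : ∀ x t, 0 ≤ t → ContDiffAt ℝ 2 w (x, t) := by
      intro x t ht
      have h1 : ContDiffAt ℝ 2 (fun p : ℝ × ℝ => r p.2) (x, t) := by
        refine ContDiffAt.sqrt ?_ (harg t ht).ne'
        fun_prop
      have h2 : ∀ c : ℝ, ContDiffAt ℝ 2 (fun p : ℝ × ℝ => GG ((p.1 + (c - p.2)) / r p.2)) (x, t) := by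
        intro c
        refine GG_contDiff.contDiffAt.comp (x, t) ?_
        refine ContDiffAt.div ?_ h1 (hr t ht).ne'
        fun_prop
      exact ((contDiffAt_const.mul (h1.mul (h2 0))).sub (h1.mul (h2 1))).add contDiffAt_const
    have hd : ∀ c x t, 0 < t → HasDerivAt (fun τ => r τ * GG ((x + (c - τ)) / r τ))
        (ε * (Real.exp (-((x + (c - t)) / r t) ^ 2) / √π * (1 / r t))
          - Phi ((x + (c - t)) / r t)) t := by
      intro c x t ht
      have h1 := K_dt r _ (x + c) t (hr t ht.le) (hrd t ht.le)
      have e : ∀ τ : ℝ, x + c - τ = x + (c - τ) := fun τ => by ring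
      simp only [e] at h1
      refine h1.congr_deriv ?_
      have := hr t ht.le
      field_simp
    have key := compare hε0.le (F := fun p => -F (-p)) (by fun_prop) (u := fun p => -u p)
      ⟨M, fun p => by rw [abs_neg]; exact hM p⟩ huc.continuousOn.neg (neg_super hsup)
      w
      (fun x t => 2 * (ε * (Real.exp (-((x + (0 - t)) / r t) ^ 2) / √π * (1 / r t))
          - Phi ((x + (0 - t)) / r t)) - (ε * (Real.exp (-((x + (1 - t)) / r t) ^ 2) / √π * (1 / r t))
          - Phi ((x + (1 - t)) / r t)))
      (fun x t => 2 * Phi ((x + (0 - t)) / r t) - Phi ((x + (1 - t)) / r t))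
      (fun x t => 2 * (Real.exp (-((x + (0 - t)) / r t) ^ 2) / √π * (1 / r t))
        - (Real.exp (-((x + (1 - t)) / r t) ^ 2) / √π * (1 / r t)))
      (fun p hp => (hw2 p.1 p.2 hp).continuousAt.continuousWithinAt)
      ⟨-1, fun p hp => by
        have hrp := hr p.2 hp
        have h1 := GG_nonneg ((p.1 + (0 - p.2)) / r p.2)
        have h2 := GG_lip ((p.1 + (0 - p.2)) / r p.2) (1 / r p.2) (by positivity)
        have e : (p.1 + (0 - p.2)) / r p.2 + 1 / r p.2 = (p.1 + (1 - p.2)) / r p.2 := by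
          field_simp; ring
        rw [e] at h2
        have h3 := mul_le_mul_of_nonneg_left h2 hrp.le
        have h4 := mul_nonneg hrp.le h1
        rw [mul_add, mul_one_div_cancel hrp.ne'] at h3
        simp only [w]
        linarith⟩
      (fun x t ht => hw2 x t ht.le)
      (fun x t ht => (((hd 0 x t ht).const_mul 2).sub (hd 1 x t ht)).add_const s)
      (fun x t ht => (((K_dx (r t) (0 - t) x (hr t ht.le)).const_mul 2).sub
        (K_dx (r t) (1 - t) x (hr t ht.le))).add_const s)
      (fun x t ht => ((K_dxx (r t) (0 - t) x).const_mul 2).sub (K_dxx (r t) (1 - t) x))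
      (fun x t ht => by
        have hrp := hr t ht.le
        have h1 : Phi ((x + (0 - t)) / r t) ≤ Phi ((x + (1 - t)) / r t) :=
          Phi_mono (div_le_div_of_nonneg_right (by linarith) hrp.le)
        have h2 := Phi_nonneg ((x + (0 - t)) / r t)
        have h3 := Phi_le_one ((x + (1 - t)) / r t)
        rw [abs_le]; constructor <;> linarith)
      (fun x t ht => by
        have hrp := hr t ht.le
        have h1 : Phi ((x + (0 - t)) / r t) ≤ Phi ((x + (1 - t)) / r t) :=
          Phi_mono (div_le_div_of_nonneg_right (by linarith) hrp.le)
        have h2 := Phi_nonneg ((x + (0 - t)) / r t)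
        have h3 := Phi_le_one ((x + (1 - t)) / r t)
        have h4 := hFle (-(2 * Phi ((x + (0 - t)) / r t) - Phi ((x + (1 - t)) / r t)))
          ⟨by linarith, by linarith⟩
        linarith)
      (fun x => by
        have hr0 : r 0 = s := by simp [r, Real.sqrt_sq hs.le]
        rw [h0, hg]
        simp only [w, hr0, sub_zero, add_zero]
        have h1 : x ≤ s * GG (x / s) := by
          have := mul_le_mul_of_nonneg_left (GG_ge_self (x / s)) hs.le
          rwa [mul_div_cancel₀ _ hs.ne'] at this
        have h2 : 0 ≤ s * GG (x / s) := mul_nonneg hs.le (GG_nonneg _)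
        have h3 : s * GG ((x + 1) / s) ≤ max (x + 1) 0 + s / 2 := by
          have := mul_le_mul_of_nonneg_left (GG_le ((x + 1) / s)) hs.le
          rw [mul_add, mul_max_of_nonneg _ _ hs.le, mul_div_cancel₀ _ hs.ne', mul_zero] at this
          linarith
        have h4 : 1 - |x| ≤ max (1 - |x|) 0 := le_max_left _ _
        have h5 : 0 ≤ max (1 - |x|) 0 := le_max_right _ _
        rcases le_total x 0 with hx | hx
        · rw [abs_of_nonpos hx] at *
          rcases le_total (x + 1) 0 with hx' | hx'
          · rw [max_eq_right hx'] at h3; linarith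
          · rw [max_eq_left hx'] at h3; linarith
        · rw [abs_of_nonneg hx] at *
          rw [max_eq_left (by linarith)] at h3; linarith)
      0 1 zero_le_one
    have hr1 := hr 1 zero_le_one
    have hrle : r 1 ≤ 1 := Real.sqrt_le_one.2 (by linarith)
    have hrge : 2 * √ε ≤ r 1 := by
      refine Real.le_sqrt_of_sq_le ?_
      rw [mul_pow, Real.sq_sqrt hε0.le]
      nlinarith
    simp only [w] at key
    rw [show ((0:ℝ) + (1 - 1)) / r 1 = 0 by simp, GG_zero,
      show ((0:ℝ) + (0 - 1)) / r 1 = -(1 / r 1) by ring] at key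
    have hG : GG (-(1 / r 1)) ≤ Real.exp (-1) / (4 * √π) := by
      refine (GG_mono ?_).trans GG_neg_one
      have : 1 ≤ 1 / r 1 := by rw [le_div_iff₀ hr1]; linarith
      linarith
    have hG' := mul_le_mul_of_nonneg_left hG hr1.le
    have he : Real.exp (-1) ≤ 1 := Real.exp_le_one_iff.2 (by norm_num)
    have hfin : √ε / √π * (1 - Real.exp (-1)) ≤ r 1 / (2 * √π) * (1 - Real.exp (-1)) := by
      refine mul_le_mul_of_nonneg_right ?_ (by linarith)
      rw [div_le_div_iff₀ hpi (by positivity)]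
      nlinarith
    have e1 : r 1 / (2 * √π) * (1 - Real.exp (-1))
      = r 1 * (1 / (2 * √π)) - 2 * (r 1 * (Real.exp (-1) / (4 * √π))) := by
      field_simp; ring
    linarith
  have hlim : Tendsto (fun s : ℝ => u (0, 1) + s) (𝓝[>] 0) (𝓝 (u (0, 1) + 0)) :=
    (Continuous.tendsto (by fun_prop) 0).mono_left nhdsWithin_le_nhds
  rw [add_zero] at hlim
  refine ge_of_tendsto hlim ?_
  have hsm : ∀ᶠ s : ℝ in 𝓝[>] 0, s ^ 2 < 1 - 4 * ε := by
    have : Tendsto (fun s : ℝ => s ^ 2) (𝓝[>] 0) (𝓝 (0 ^ 2)) :=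
      (Continuous.tendsto (by fun_prop) 0).mono_left nhdsWithin_le_nhds
    exact this.eventually_lt_const (by norm_num; linarith)
  filter_upwards [self_mem_nhdsWithin, hsm] with s hs hs2
  exact main s hs hs2

end

/-- Let `ε ∈ (0,1/4)` and `m > 1` with `1 - 1/m ≤ ((e-1)/(2√π e))√ε`.
If `F ∈ Lip_loc(ℝ)` satisfies `F(p) = pᵐ/m` on `[0,1]` and `F(p) ≤ p` on `[-1,0]`, and
`g(x) = max{1-|x|,0}`, then the viscosity solutions `u^ε` of `u_t + F(u_x) = ε u_xx` and
`u` of `u_t + F(u_x) = 0` with initial datum `g` satisfy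
`|u^ε(0,1) - u(0,1)| ≥ ((e-1)/(2√π e)) √ε`. -/
theorem statement11
    (ε : ℝ) (hε : ε ∈ Set.Ioo (0:ℝ) (1/4))
    (m : ℝ) (hm : 1 < m)
    (hmε : 1 - 1/m ≤ (Real.exp 1 - 1) / (2 * Real.sqrt Real.pi * Real.exp 1) * Real.sqrt ε)
    (F : ℝ → ℝ) (hF : LocallyLipschitz F)
    (hF1 : ∀ p ∈ Set.Icc (0:ℝ) 1, F p = p ^ m / m)
    (hF2 : ∀ p ∈ Set.Icc (-1:ℝ) 0, F p ≤ p)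
    (g : ℝ → ℝ) (hg : ∀ x : ℝ, g x = max (1 - |x|) 0)
    (uε u : ℝ × ℝ → ℝ)
    (huε : IsViscositySolutionCauchy F ε g uε)
    (hu : IsViscositySolutionCauchy F 0 g u) :
    (Real.exp 1 - 1) / (2 * Real.sqrt Real.pi * Real.exp 1) * Real.sqrt ε
      ≤ |uε (0, 1) - u (0, 1)| := by

  have hFc := hF.continuous
  have hFle : ∀ p ∈ Set.Icc (-1:ℝ) 1, F p ≤ p := by
    rintro p ⟨hp1, hp2⟩
    rcases le_total p 0 with h | h
    · exact hF2 p ⟨hp1, h⟩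
    · rw [hF1 p ⟨h, hp2⟩]
      have h1 : p ^ m ≤ p := by
        simpa using Real.rpow_le_rpow_of_exponent_ge_of_imp h hp2 hm.le (by intro _ h0; linarith)
      exact (div_le_self (Real.rpow_nonneg h m) hm.le).trans h1
  have hU := upper_bound hm hFc hF1 hg hu
  have hL := lower_bound hε hFc hFle hg huε
  have hpi := sqrtpi_pos
  have hC : Real.sqrt ε / Real.sqrt Real.pi * (1 - Real.exp (-1))
      = 2 * ((Real.exp 1 - 1) / (2 * Real.sqrt Real.pi * Real.exp 1) * Real.sqrt ε) := by
    rw [Real.exp_neg]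
    have := Real.exp_pos 1
    field_simp
  rw [hC] at hL
  exact le_trans (by linarith) (le_abs_self _)
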